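/- Let P be the group defined by the presentation ⟨x, y, z ∣ x⁴ = y⁴ = [x,y] = 1, z² = x², z·x·z⁻¹ = x·y², z·y·z⁻¹ = x²·y⟩, where [x,y] = x·y·x⁻¹·y⁻¹. Then P has order 32 and the automorphism group Aut(P) is a 2-group. -/

import Mathlib

/-- The relations of the presentation
`⟨x, y, z ∣ x⁴ = y⁴ = [x,y] = 1, z² = x², z x z⁻¹ = x y², z y z⁻¹ = x² y⟩`,
with generators `x = 0`, `y = 1`, `z = 2`. -/
def minNonmetacyclicRels : Set (FreeGroup (Fin 3)) :=
  let x : FreeGroup (Fin 3) := FreeGroup.of 0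
  let y : FreeGroup (Fin 3) := FreeGroup.of 1
  let z : FreeGroup (Fin 3) := FreeGroup.of 2
  {x ^ 4, y ^ 4, x * y * x⁻¹ * y⁻¹, z ^ 2 * (x ^ 2)⁻¹,
    z * x * z⁻¹ * (x * y ^ 2)⁻¹, z * y * z⁻¹ * (x ^ 2 * y)⁻¹}

/-- Normal forms `x ^ a * y ^ b * z ^ c`, recorded by their exponents, as a model of the group
presented by `minNonmetacyclicRels`. -/
structure NormalForm where
  a : ZMod 4
  b : ZMod 4
  c : ZMod 2
deriving DecidableEq, Fintype

namespace NormalForm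

/-- Doubling, as a map `ZMod 2 → ZMod 4`. -/
def dbl (c : ZMod 2) : ZMod 4 := if c = 0 then 0 else 2

instance : Mul NormalForm :=
  ⟨fun g h => ⟨g.a + h.a + dbl g.c * h.b + dbl (g.c * h.c), g.b + h.b + dbl g.c * h.a, g.c + h.c⟩⟩

instance : One NormalForm := ⟨⟨0, 0, 0⟩⟩

instance : Inv NormalForm :=
  ⟨fun g => ⟨-g.a + dbl g.c * g.b + dbl g.c, -g.b + dbl g.c * g.a, g.c⟩⟩

lemma mul_def (g h : NormalForm) : g * h =
    ⟨g.a + h.a + dbl g.c * h.b + dbl (g.c * h.c), g.b + h.b + dbl g.c * h.a, g.c + h.c⟩ := rfl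

lemma dbl_add : ∀ c d, dbl (c + d) = dbl c + dbl d := by decide

lemma dbl_mul_dbl : ∀ c d, dbl c * dbl d = 0 := by decide

lemma dbl_mul_dbl_mul : ∀ c d e, dbl c * dbl (d * e) = 0 := by decide

instance : Group NormalForm :=
  Group.ofLeftAxioms
    (by
      intro g h k
      simp only [mul_def, mk.injEq]
      refine ⟨?_, ?_, by ring⟩
      · simp only [add_mul, mul_add, dbl_add]
        linear_combination -dbl_mul_dbl g.c h.c * k.a
      · simp only [mul_add, dbl_add]
        linear_combination -dbl_mul_dbl g.c h.c * k.b - dbl_mul_dbl_mul g.c h.c k.c)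
    (by decide) (by decide)

/-- The generator `x`. -/
def x : NormalForm := ⟨1, 0, 0⟩

/-- The generator `y`. -/
def y : NormalForm := ⟨0, 1, 0⟩

/-- The generator `z`. -/
def z : NormalForm := ⟨0, 0, 1⟩

lemma eq_prod : ∀ g : NormalForm, g = x ^ g.a.val * y ^ g.b.val * z ^ g.c.val := by decide +kernel

/-- The quotient map onto the elementary abelian group `P / Φ(P)`, written additively. -/
def toFrattiniQuotient : NormalForm →* Multiplicative (ZMod 2 × ZMod 2 × ZMod 2) where
  toFun g := .ofAdd (g.a.cast, g.b.cast, g.c)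
  map_one' := by decide
  map_mul' := by decide +kernel

local notation "π" => toFrattiniQuotient

lemma hom_ext {M : Type*} [Monoid M] {f g : NormalForm →* M} (hx : f x = g x) (hy : f y = g y)
    (hz : f z = g z) : f = g := by
  ext w
  rw [eq_prod w]
  simp [hx, hy, hz]

lemma sq_eq_sq_of_mod_frattini : ∀ g h, π g = π h → g ^ 2 = h ^ 2 := by decide +kernel

lemma exists_sq_of_mem_frattini : ∀ u, π u = 1 → ∃ w : NormalForm, u = w ^ 2 := by decide +kernel

lemma sq_mem_frattini : ∀ w, π (w ^ 2) = 1 := by decide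

lemma sq_eq_one_of_mem_frattini : ∀ u, π u = 1 → u * u = 1 := by decide

lemma map_mod_frattini (f : MulAut NormalForm) {g h : NormalForm} (e : π g = π h) :
    π (f g) = π (f h) := by
  obtain ⟨w, hw⟩ := exists_sq_of_mem_frattini (h⁻¹ * g) (by simp [e])
  rw [inv_mul_eq_iff_eq_mul.mp hw, map_mul, map_mul, map_pow f, sq_mem_frattini, mul_one]

set_option synthInstance.maxSize 1024 in
/-- The only elements modulo `Φ(P)` that can be the images of the generators under an
automorphism. -/
lemma mod_frattini_of_relations : ∀ p q : NormalForm, p * q = q * p ∧ p ^ 2 ≠ 1 ∧ q ^ 2 ≠ 1 ∧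
    p ^ 2 ≠ q ^ 2 → ∀ r : NormalForm, r ^ 2 = p ^ 2 ∧ r * p = p * q ^ 2 * r ∧
    r * q = p ^ 2 * q * r →
    (π p = π x ∧ π q = π y ∧ (π r = π z ∨ π r = π (x * y * z))) ∨ (π p = π y ∧ π q = π x) := by
  decide +kernel

lemma generators_mod_frattini (f : MulAut NormalForm) :
    (π (f x) = π x ∧ π (f y) = π y ∧ (π (f z) = π z ∨ π (f z) = π (x * y * z))) ∨
      (π (f x) = π y ∧ π (f y) = π x) := by
  apply mod_frattini_of_relations <;> split_ands <;> simp only [← map_mul, ← map_pow, ne_eq,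
    EmbeddingLike.apply_eq_iff_eq, EmbeddingLike.map_eq_one_iff] <;> decide

lemma sq_fixes_mod_frattini (f : MulAut NormalForm) :
    π ((f ^ 2) x) = π x ∧ π ((f ^ 2) y) = π y := by
  rw [pow_two, MulAut.mul_apply, MulAut.mul_apply]
  rcases generators_mod_frattini f with ⟨hx, hy, -⟩ | ⟨hx, hy⟩
  · exact ⟨(map_mod_frattini f hx).trans hx, (map_mod_frattini f hy).trans hy⟩
  · exact ⟨(map_mod_frattini f hx).trans hy, (map_mod_frattini f hy).trans hx⟩

lemma sq_mod_frattini_of_fixes {f : MulAut NormalForm} (hx : π (f x) = π x)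
    (hy : π (f y) = π y) (g : NormalForm) : π ((f ^ 2) g) = π g := by
  have hz : π (f (f z)) = π z := by
    rcases generators_mod_frattini f with ⟨-, -, hz | hz⟩ | ⟨h, -⟩
    · exact (map_mod_frattini f hz).trans hz
    · rw [map_mod_frattini f hz, map_mul, map_mul, map_mul, map_mul, hx, hy, hz]
      decide
    · exact absurd (hx.symm.trans h) (by decide)
  refine DFunLike.congr_fun
    (hom_ext (f := (π).comp (f ^ 2 : MulAut NormalForm).toMonoidHom) (g := π) ?_ ?_ ?_) g
  · exact (map_mod_frattini f hx).trans hx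
  · exact (map_mod_frattini f hy).trans hy
  · exact hz

lemma sq_eq_one_of_mod_frattini {f : MulAut NormalForm} (hf : ∀ g, π (f g) = π g) :
    f ^ 2 = 1 := by
  ext1 g
  have hu : π (g⁻¹ * f g) = 1 := by simp [hf]
  obtain ⟨w, hw⟩ := exists_sq_of_mem_frattini _ hu
  have hfix : f (g⁻¹ * f g) = g⁻¹ * f g := by
    rw [hw, map_pow, sq_eq_sq_of_mod_frattini _ _ (hf w)]
  have h1 := sq_eq_one_of_mem_frattini _ hu
  rw [pow_two, MulAut.mul_apply, MulAut.one_apply]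
  calc f (f g) = f g * f (g⁻¹ * f g) := by simp
    _ = g * ((g⁻¹ * f g) * (g⁻¹ * f g)) := by rw [hfix]; group
    _ = g := by rw [h1, mul_one]

theorem isPGroup_mulAut : IsPGroup 2 (MulAut NormalForm) := fun f => by
  refine ⟨3, ?_⟩
  obtain ⟨hx, hy⟩ := sq_fixes_mod_frattini f
  rw [show 2 ^ 3 = 2 * 2 * 2 by norm_num, pow_mul, pow_mul]
  exact sq_eq_one_of_mod_frattini (sq_mod_frattini_of_fixes hx hy)

/-- The homomorphism from the presented group sending the generators to `x`, `y`, `z`. -/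
def ofPresented : PresentedGroup minNonmetacyclicRels →* NormalForm :=
  PresentedGroup.toGroup (f := ![x, y, z]) <| by
    rintro r (rfl | rfl | rfl | rfl | rfl | rfl) <;>
      simp only [map_mul, map_pow, map_inv, FreeGroup.lift_apply_of] <;> decide

/-- The element of a group with the given exponents with respect to `X`, `Y`, `Z`. -/
def eval {G : Type*} [Group G] (X Y Z : G) (g : NormalForm) : G :=
  X ^ g.a.val * Y ^ g.b.val * Z ^ g.c.val

section Eval

variable {G : Type*} [Group G] {X Y Z : G}

lemma eval_natCast (hX : X ^ 4 = 1) (hY : Y ^ 4 = 1) (a b : ℕ) (c : ZMod 2) :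
    eval X Y Z ⟨a, b, c⟩ = X ^ a * Y ^ b * Z ^ c.val := by
  simp only [eval, ZMod.val_natCast, ← pow_eq_pow_mod _ hX, ← pow_eq_pow_mod _ hY]

lemma exists_natCast (g : NormalForm) : ∃ (a b : ℕ) (c : ZMod 2), g = ⟨a, b, c⟩ :=
  ⟨g.a.val, g.b.val, g.c, by simp⟩

lemma eval_x_mul (hX : X ^ 4 = 1) (hY : Y ^ 4 = 1) (g : NormalForm) :
    X * eval X Y Z g = eval X Y Z (x * g) := by
  obtain ⟨a, b, c, rfl⟩ := exists_natCast g
  have h : x * ⟨a, b, c⟩ = ⟨(a + 1 : ℕ), b, c⟩ := by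
    simp [mul_def, x, dbl, add_comm]
  rw [h, eval_natCast hX hY, eval_natCast hX hY, pow_succ']
  group

lemma eval_y_mul (hX : X ^ 4 = 1) (hY : Y ^ 4 = 1) (hXY : Commute X Y) (g : NormalForm) :
    Y * eval X Y Z g = eval X Y Z (y * g) := by
  obtain ⟨a, b, c, rfl⟩ := exists_natCast g
  have h : y * ⟨a, b, c⟩ = ⟨a, (b + 1 : ℕ), c⟩ := by
    simp [mul_def, y, dbl, add_comm]
  rw [h, eval_natCast hX hY, eval_natCast hX hY, pow_succ', ← mul_assoc, ← mul_assoc,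
    ← (hXY.pow_left a).eq, mul_assoc (X ^ a)]

lemma eval_z_mul (hX : X ^ 4 = 1) (hY : Y ^ 4 = 1) (hXY : Commute X Y) (hZ : Z ^ 2 = X ^ 2)
    (hZX : SemiconjBy Z X (X * Y ^ 2)) (hZY : SemiconjBy Z Y (X ^ 2 * Y)) (g : NormalForm) :
    Z * eval X Y Z g = eval X Y Z (z * g) := by
  obtain ⟨a, b, c, rfl⟩ := exists_natCast g
  have key : Z * (X ^ a * Y ^ b) = X ^ (a + 2 * b) * Y ^ (b + 2 * a) * Z := by
    rw [((hZX.pow_right a).mul_right (hZY.pow_right b)).eq, (hXY.pow_right 2).mul_pow,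
      (hXY.pow_left 2).mul_pow, ← pow_mul, ← pow_mul, pow_add X, add_comm b, pow_add Y]
    simp only [mul_assoc]
    rw [← mul_assoc (Y ^ (2 * a)), ← (hXY.pow_pow _ _).eq]
    simp only [mul_assoc]
  rw [eval_natCast hX hY, ← mul_assoc, key]
  obtain rfl | rfl : c = 0 ∨ c = 1 := by revert c; decide
  · have h : z * ⟨a, b, 0⟩ = ⟨(a + 2 * b : ℕ), (b + 2 * a : ℕ), 1⟩ := by
      simp [mul_def, z, dbl]
    rw [h, eval_natCast hX hY]
    simp [ZMod.val_one]
  · have h : z * ⟨a, b, 1⟩ = ⟨(a + 2 * b + 2 : ℕ), (b + 2 * a : ℕ), 0⟩ := by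
      simp [mul_def, z, dbl]
      decide
    rw [h, eval_natCast hX hY, ZMod.val_one, ZMod.val_zero, pow_one, pow_zero, mul_one, mul_assoc,
      ← pow_two, hZ, mul_assoc, ← (hXY.pow_pow _ _).eq, ← mul_assoc, ← pow_add]

end Eval

/-- The canonical generators of the presented group. -/
abbrev gen (i : Fin 3) : PresentedGroup minNonmetacyclicRels := PresentedGroup.of i

lemma mul_eval_gen (w : PresentedGroup minNonmetacyclicRels) :
    ∀ g, w * eval (gen 0) (gen 1) (gen 2) g = eval (gen 0) (gen 1) (gen 2) (ofPresented w * g) := by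
  have rel {r} (hr : r ∈ minNonmetacyclicRels) :
      (PresentedGroup.mk minNonmetacyclicRels r) = 1 := PresentedGroup.one_of_mem hr
  have hX : gen 0 ^ 4 = 1 := rel (.inl rfl)
  have hY : gen 1 ^ 4 = 1 := rel (.inr <| .inl rfl)
  have hXY : gen 0 * gen 1 * (gen 0)⁻¹ * (gen 1)⁻¹ = 1 := rel (.inr <| .inr <| .inl rfl)
  have hZ : gen 2 ^ 2 * (gen 0 ^ 2)⁻¹ = 1 := rel (.inr <| .inr <| .inr <| .inl rfl)
  have hZX : gen 2 * gen 0 * (gen 2)⁻¹ * (gen 0 * gen 1 ^ 2)⁻¹ = 1 :=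
    rel (.inr <| .inr <| .inr <| .inr <| .inl rfl)
  have hZY : gen 2 * gen 1 * (gen 2)⁻¹ * (gen 0 ^ 2 * gen 1)⁻¹ = 1 :=
    rel (.inr <| .inr <| .inr <| .inr <| .inr rfl)
  have hXY' : Commute (gen 0) (gen 1) := mul_inv_eq_iff_eq_mul.mp (mul_inv_eq_one.mp hXY)
  have hw : w ∈ Subgroup.closure (Set.range gen) := by
    rw [PresentedGroup.closure_range_of]; trivial
  induction hw using Subgroup.closure_induction with
  | mem w hw =>
    obtain ⟨i, rfl⟩ := hw
    intro g
    rw [ofPresented, PresentedGroup.toGroup.of]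
    fin_cases i
    · exact eval_x_mul hX hY g
    · exact eval_y_mul hX hY hXY' g
    · exact eval_z_mul hX hY hXY' (mul_inv_eq_one.mp hZ)
        (mul_inv_eq_iff_eq_mul.mp (mul_inv_eq_one.mp hZX))
        (mul_inv_eq_iff_eq_mul.mp (mul_inv_eq_one.mp hZY)) g
  | one => simp
  | mul v w _ _ hv hw => intro g; rw [mul_assoc, hw, hv, map_mul, mul_assoc]
  | inv w _ hw => intro g; rw [inv_mul_eq_iff_eq_mul, hw, map_inv, mul_inv_cancel_left]

/-- The presented group is isomorphic to its model by normal forms. -/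
def presentedEquiv : PresentedGroup minNonmetacyclicRels ≃* NormalForm where
  __ := ofPresented
  invFun := eval (gen 0) (gen 1) (gen 2)
  left_inv w := by
    have h := mul_eval_gen w 1
    rw [mul_one] at h
    change eval (gen 0) (gen 1) (gen 2) (ofPresented w) = w
    rw [← h]
    simp [eval, show (1 : NormalForm) = ⟨0, 0, 0⟩ from rfl]
  right_inv g := by
    change ofPresented (eval (gen 0) (gen 1) (gen 2) g) = g
    conv_rhs => rw [eq_prod g]
    simp only [eval, map_mul, map_pow, ofPresented, PresentedGroup.toGroup.of]
    rfl

end NormalForm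

/-- The group
`P = ⟨x, y, z ∣ x⁴ = y⁴ = [x,y] = 1, z² = x², z x z⁻¹ = x y², z y z⁻¹ = x² y⟩`
has order `32`, and its automorphism group is a 2-group. -/
theorem stmt18 :
    Nat.card (PresentedGroup minNonmetacyclicRels) = 32 ∧
      IsPGroup 2 (MulAut (PresentedGroup minNonmetacyclicRels)) := by
  refine ⟨?_, NormalForm.isPGroup_mulAut.of_equiv
    (MulAut.congr NormalForm.presentedEquiv).symm⟩
  rw [Nat.card_congr NormalForm.presentedEquiv.toEquiv, Nat.card_eq_fintype_card]
  decide +kernel
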